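/- arXiv:1404.5119 — 2 statements merged into one kernel-verified Lean document; each statement's English description precedes it below -/
import Mathlib

section
/- Fix real numbers X_a, X_b, X_c ∈ (0,1) with X_a ≠ X_b X_c. Let (q_n) be a sequence of reals in (0,1) with q_n → 1, and let (a_n, b_n, c_n) be admissible triples with (a_n + 2, b_n, c_n) also admissible, such that q_n^{a_n/2} → X_a, q_n^{b_n/2} → X_b, q_n^{c_n/2} → X_c. Then the ratio of consecutive theta-graph invariants converges: J_{a_n+2, b_n, c_n}(Θ;q_n) / J_{a_n, b_n, c_n}(Θ;q_n) → y_a, where y_a = − X_a (X_a X_b − X_c)(X_a X_c − X_b)(1 − X_a X_b X_c) / ( X_b X_c (1 − X_a²)² (X_a − X_b X_c) ); in particular the limit y_a satisfies the classical A-polynomial equation A_a(y_a; X_a, X_b, X_c) = 0. -/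
open Real Finset Filter

/-- The quantum number `[n] = (q^{n/2} - q^{-n/2})/(q^{1/2} - q^{-1/2})`. -/
noncomputable def qNum (q : ℝ) (n : ℤ) : ℝ :=
  (q ^ ((n : ℝ) / 2) - q ^ (-((n : ℝ) / 2))) / (q ^ ((1 : ℝ) / 2) - q ^ (-((1 : ℝ) / 2)))

/-- The quantum factorial `[n]! = [n][n-1]⋯[1]`, with `[0]! = 1`. -/
noncomputable def qFact (q : ℝ) (n : ℕ) : ℝ := ∏ k ∈ Finset.range n, qNum q (k + 1)

/-- A triple `(a,b,c)` of nonnegative integers is admissible if `a+b+c` is even,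
`|a - b| ≤ c` and `c ≤ a + b`. -/
def Admissible (a b c : ℕ) : Prop :=
  Even (a + b + c) ∧ a ≤ b + c ∧ b ≤ a + c ∧ c ≤ a + b

/-- The quantum invariant of the theta graph colored by an admissible triple `(a,b,c)`:
`J_{a,b,c}(Θ;q) = (-1)^{(a+b+c)/2} [(a+b+c)/2+1]! [(-a+b+c)/2]! [(a-b+c)/2]! [(a+b-c)/2]!
  / ([a]![b]![c]!)`. -/
noncomputable def thetaInv (q : ℝ) (a b c : ℕ) : ℝ :=
  (-1 : ℝ) ^ ((a + b + c) / 2) *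
    (qFact q ((a + b + c) / 2 + 1) * qFact q ((b + c - a) / 2) *
      qFact q ((a + c - b) / 2) * qFact q ((a + b - c) / 2)) /
    (qFact q a * qFact q b * qFact q c)

/-- The classical A-polynomial of the theta graph in the `a`-direction:
`A_a(y; x_a,x_b,x_c) = x_a(x_a x_b - x_c)(x_a x_c - x_b)(1 - x_a x_b x_c)
  + x_b x_c (1 - x_a²)² (x_a - x_b x_c) y`. -/
noncomputable def thetaApolyA (y xa xb xc : ℝ) : ℝ :=
  xa * (xa * xb - xc) * (xa * xc - xb) * (1 - xa * xb * xc) +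
    xb * xc * (1 - xa ^ 2) ^ 2 * (xa - xb * xc) * y

theorem sq_rpow_natCast_div_two {t : ℝ} (ht : 0 < t) (m : ℕ) : (t ^ 2) ^ ((m : ℝ) / 2) = t ^ m := by
  rw [← rpow_natCast t 2, ← rpow_mul ht.le, ← rpow_natCast t m]
  congr 1
  push_cast
  ring

/-- The quantum number `[n]` in terms of natural powers of `t = q^{1/2}`. -/
theorem qNum_sq_natCast {t : ℝ} (ht : 0 < t) (n : ℕ) :
    qNum (t ^ 2) n = (t ^ n - (t ^ n)⁻¹) / (t - t⁻¹) := by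
  have h1 := sq_rpow_natCast_div_two ht 1
  rw [Nat.cast_one, pow_one] at h1
  simp only [qNum, Int.cast_natCast]
  rw [rpow_neg (by positivity), rpow_neg (by positivity),
    sq_rpow_natCast_div_two ht, h1]

theorem qNum_natCast_ne_zero {q : ℝ} (hq : q ∈ Set.Ioo (0 : ℝ) 1) {n : ℕ} (hn : n ≠ 0) :
    qNum q n ≠ 0 := by
  obtain ⟨h0, h1⟩ := hq
  have key {x : ℝ} (hx : 0 < x) : q ^ x - q ^ (-x) ≠ 0 :=
    (sub_neg.2 (rpow_lt_rpow_of_exponent_gt h0 h1 (by linarith))).ne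
  have hn' : (0 : ℝ) < n := by exact_mod_cast Nat.pos_of_ne_zero hn
  refine div_ne_zero ?_ (key (by norm_num))
  rw [Int.cast_natCast]
  exact key (by positivity)

theorem qFact_succ (q : ℝ) (n : ℕ) : qFact q (n + 1) = qFact q n * qNum q (n + 1 : ℕ) := by
  simp [qFact, prod_range_succ]

theorem qFact_ne_zero {q : ℝ} (hq : q ∈ Set.Ioo (0 : ℝ) 1) (n : ℕ) : qFact q n ≠ 0 :=
  prod_ne_zero_iff.2 fun k _ => by
    exact_mod_cast qNum_natCast_ne_zero hq k.succ_ne_zero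

/-- The theta invariant in terms of the numbers `i, j, k` of strands between the vertices. -/
theorem thetaInv_strands (q : ℝ) (i j k : ℕ) :
    thetaInv q (j + k) (i + k) (i + j) =
      (-1 : ℝ) ^ (i + j + k) *
        (qFact q (i + j + k + 1) * qFact q i * qFact q j * qFact q k) /
          (qFact q (j + k) * qFact q (i + k) * qFact q (i + j)) := by
  have h1 : (j + k + (i + k) + (i + j)) / 2 = i + j + k := by omega
  have h2 : (i + k + (i + j) - (j + k)) / 2 = i := by omega
  have h3 : (j + k + (i + j) - (i + k)) / 2 = j := by omega
  have h4 : (j + k + (i + k) - (i + j)) / 2 = k := by omega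
  rw [thetaInv, h1, h2, h3, h4]

theorem thetaInv_ratio_qNum {q : ℝ} (hq : q ∈ Set.Ioo (0 : ℝ) 1) (i j k : ℕ) :
    thetaInv q (j + k + 2) (i + 1 + k) (i + 1 + j) / thetaInv q (j + k) (i + 1 + k) (i + 1 + j) =
      -(qNum q (i + j + k + 3 : ℕ) * qNum q (j + 1 : ℕ) * qNum q (k + 1 : ℕ)) /
        (qNum q (i + 1 : ℕ) * qNum q (j + k + 1 : ℕ) * qNum q (j + k + 2 : ℕ)) := by
  have e1 : thetaInv q (j + k + 2) (i + 1 + k) (i + 1 + j) =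
      thetaInv q (j + 1 + (k + 1)) (i + (k + 1)) (i + (j + 1)) := by
    congr 1 <;> ring
  rw [e1, thetaInv_strands, thetaInv_strands,
    show i + (j + 1) + (k + 1) + 1 = i + j + k + 2 + 1 by ring,
    show i + 1 + j + k + 1 = i + j + k + 2 by ring,
    show j + 1 + (k + 1) = j + k + 1 + 1 by ring,
    show i + (k + 1) = i + 1 + k by ring, show i + (j + 1) = i + 1 + j by ring,
    show i + 1 + j + (k + 1) = i + 1 + j + k + 1 by ring,
    qFact_succ q (i + j + k + 2), qFact_succ q i, qFact_succ q j, qFact_succ q k,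
    qFact_succ q (j + k + 1), qFact_succ q (j + k), pow_succ]
  have hF := qFact_ne_zero hq
  have hN {n : ℕ} (hn : n ≠ 0) := qNum_natCast_ne_zero hq hn
  have n1 := hN i.succ_ne_zero
  have n2 := hN (j + k).succ_ne_zero
  have n3 := hN (j + k + 1).succ_ne_zero
  have f1 := hF (i + j + k + 2)
  have f2 := hF i
  have f3 := hF j
  have f4 := hF k
  have f5 := hF (j + k)
  have f6 := hF (i + 1 + k)
  have f7 := hF (i + 1 + j)
  have hs : (-1 : ℝ) ^ (i + 1 + j + k) ≠ 0 := pow_ne_zero _ (by norm_num)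
  field_simp

/-- The quantum recursion of the theta graph in the `a`-direction. -/
theorem thetaInv_ratio {q : ℝ} (hq : q ∈ Set.Ioo (0 : ℝ) 1) {a b c : ℕ}
    (h : Admissible a b c) (h' : Admissible (a + 2) b c) {A B C : ℝ}
    (hA : A = q ^ ((a : ℝ) / 2)) (hB : B = q ^ ((b : ℝ) / 2)) (hC : C = q ^ ((c : ℝ) / 2)) :
    thetaInv q (a + 2) b c / thetaInv q a b c =
      -((1 - A * B * C * q ^ 2) * (1 - A * C / B * q) * (1 - A * B / C * q)) /
        (√q * ((1 - B * C / A) * (1 - A ^ 2 * q) * (1 - A ^ 2 * q ^ 2))) := by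
  obtain ⟨i, j, k, rfl, rfl, rfl⟩ :
      ∃ i j k : ℕ, a = j + k ∧ b = i + 1 + k ∧ c = i + 1 + j := by
    obtain ⟨⟨s, hs⟩, h1, h2, h3⟩ := h
    obtain ⟨-, h4, -, -⟩ := h'
    exact ⟨s - a - 1, s - b, s - c, by omega, by omega, by omega⟩
  rw [thetaInv_ratio_qNum hq]
  obtain ⟨t, ht, rfl⟩ : ∃ t : ℝ, 0 < t ∧ q = t ^ 2 :=
    ⟨√q, sqrt_pos.2 hq.1, (sq_sqrt hq.1.le).symm⟩
  have ht1 : t < 1 := (sq_lt_one_iff₀ ht.le).1 hq.2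
  rw [sq_rpow_natCast_div_two ht] at hA hB hC
  have hpow {n : ℕ} (hn : n ≠ 0) : 1 - (t ^ n) ^ 2 ≠ 0 := by
    rw [← pow_mul]
    exact (sub_pos.2 (pow_lt_one₀ ht.le ht1 (by omega))).ne'
  have hnum (n : ℕ) : qNum (t ^ 2) n = t / (1 - t ^ 2) * ((1 - (t ^ n) ^ 2) / t ^ n) := by
    have h1 : 1 - t ^ 2 ≠ 0 := by simpa using hpow one_ne_zero
    have h2 : t - t⁻¹ ≠ 0 := by
      have : t - t⁻¹ = -(1 - t ^ 2) / t := by field_simp; ring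
      rw [this]
      exact div_ne_zero (neg_ne_zero.2 h1) ht.ne'
    have h3 : t ^ 2 - 1 ≠ 0 := by rwa [← neg_ne_zero, neg_sub]
    rw [qNum_sq_natCast ht]
    field_simp
    ring
  have hd : t / (1 - t ^ 2) ≠ 0 :=
    div_ne_zero ht.ne' (by simpa using hpow one_ne_zero)
  have m1 : A * B * C * (t ^ 2) ^ 2 = (t ^ (i + j + k + 3)) ^ 2 := by
    subst hA hB hC; ring
  have m2 : A * C / B * t ^ 2 = (t ^ (j + 1)) ^ 2 := by
    subst hA hB hC; field_simp; ring
  have m3 : A * B / C * t ^ 2 = (t ^ (k + 1)) ^ 2 := by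
    subst hA hB hC; field_simp; ring
  have m4 : B * C / A = (t ^ (i + 1)) ^ 2 := by
    subst hA hB hC; field_simp; ring
  have m5 : A ^ 2 * t ^ 2 = (t ^ (j + k + 1)) ^ 2 := by
    subst hA; ring
  have m6 : A ^ 2 * (t ^ 2) ^ 2 = (t ^ (j + k + 2)) ^ 2 := by
    subst hA; ring
  rw [m1, m2, m3, m4, m5, m6, sqrt_sq ht.le]
  simp only [hnum]
  have p1 := hpow i.succ_ne_zero
  have p2 := hpow (j + k).succ_ne_zero
  have p3 := hpow (j + k + 1).succ_ne_zero
  have hT : t ^ (i + 1) * t ^ (j + k + 1) * t ^ (j + k + 2) * t =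
      t ^ (i + j + k + 3) * t ^ (j + 1) * t ^ (k + 1) := by ring
  have hT1 : t ^ (i + 1) ≠ 0 := by positivity
  have hT2 : t ^ (j + k + 1) ≠ 0 := by positivity
  have hT3 : t ^ (j + k + 2) ≠ 0 := by positivity
  have hS1 : t ^ (i + j + k + 3) ≠ 0 := by positivity
  have hS2 : t ^ (j + 1) ≠ 0 := by positivity
  have hS3 : t ^ (k + 1) ≠ 0 := by positivity
  clear hnum m1 m2 m3 m4 m5 m6 hA hB hC
  generalize t / (1 - t ^ 2) = d at *
  generalize t ^ (i + 1) = T1 at *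
  generalize t ^ (j + k + 1) = T2 at *
  generalize t ^ (j + k + 2) = T3 at *
  generalize t ^ (i + j + k + 3) = S1 at *
  generalize t ^ (j + 1) = S2 at *
  generalize t ^ (k + 1) = S3 at *
  rw [div_eq_div_iff (by simp_all) (by simp_all [ht.ne'])]
  field_simp
  linear_combination -(1 - S1 ^ 2) * (1 - S2 ^ 2) * (1 - S3 ^ 2) * hT

/-- In the double scaling limit `q_n → 1`, `q_n^{a_n/2} → X_a`, `q_n^{b_n/2} → X_b`,
`q_n^{c_n/2} → X_c`, the ratio of consecutive theta-graph invariants converges to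
`y_a = -X_a(X_aX_b - X_c)(X_aX_c - X_b)(1 - X_aX_bX_c)/(X_bX_c(1 - X_a²)²(X_a - X_bX_c))`,
which satisfies the classical A-polynomial equation `A_a(y_a; X_a,X_b,X_c) = 0`. -/
theorem theta_ratio_limit (Xa Xb Xc : ℝ)
    (hXa : Xa ∈ Set.Ioo (0 : ℝ) 1) (hXb : Xb ∈ Set.Ioo (0 : ℝ) 1)
    (hXc : Xc ∈ Set.Ioo (0 : ℝ) 1) (hne : Xa ≠ Xb * Xc)
    (q : ℕ → ℝ) (a b c : ℕ → ℕ)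
    (hq : ∀ n, q n ∈ Set.Ioo (0 : ℝ) 1)
    (hq1 : Tendsto q atTop (nhds 1))
    (hadm : ∀ n, Admissible (a n) (b n) (c n))
    (hadm2 : ∀ n, Admissible (a n + 2) (b n) (c n))
    (hXa' : Tendsto (fun n => q n ^ ((a n : ℝ) / 2)) atTop (nhds Xa))
    (hXb' : Tendsto (fun n => q n ^ ((b n : ℝ) / 2)) atTop (nhds Xb))
    (hXc' : Tendsto (fun n => q n ^ ((c n : ℝ) / 2)) atTop (nhds Xc))
    (ya : ℝ)
    (hya : ya = -(Xa * (Xa * Xb - Xc) * (Xa * Xc - Xb) * (1 - Xa * Xb * Xc)) /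
      (Xb * Xc * (1 - Xa ^ 2) ^ 2 * (Xa - Xb * Xc))) :
    Tendsto (fun n =>
        thetaInv (q n) (a n + 2) (b n) (c n) / thetaInv (q n) (a n) (b n) (c n))
      atTop (nhds ya) ∧
    thetaApolyA ya Xa Xb Xc = 0 := by
  obtain ⟨ha0, ha1⟩ := hXa
  have hb0 := hXb.1
  have hc0 := hXc.1
  have h1 : 1 - Xb * Xc / Xa ≠ 0 := by
    rw [sub_ne_zero, ne_comm, Ne, div_eq_one_iff_eq ha0.ne']
    exact hne.symm
  have h2 : 1 - Xa ^ 2 ≠ 0 := (sub_pos.2 (pow_lt_one₀ ha0.le ha1 two_ne_zero)).ne'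
  have h3 : Xa - Xb * Xc ≠ 0 := sub_ne_zero.2 hne
  constructor
  · have hlim : Tendsto (fun n => thetaInv (q n) (a n + 2) (b n) (c n) /
        thetaInv (q n) (a n) (b n) (c n)) atTop
        (nhds (-((1 - Xa * Xb * Xc * 1 ^ 2) * (1 - Xa * Xc / Xb * 1) * (1 - Xa * Xb / Xc * 1)) /
          (√1 * ((1 - Xb * Xc / Xa) * (1 - Xa ^ 2 * 1) * (1 - Xa ^ 2 * 1 ^ 2))))) := by
      simp only [fun n => thetaInv_ratio (hq n) (hadm n) (hadm2 n) rfl rfl rfl]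
      have habc := (hXa'.mul hXb').mul hXc'
      have hac := (hXa'.mul hXc').div hXb' hb0.ne'
      have hab := (hXa'.mul hXb').div hXc' hc0.ne'
      have hbc := (hXb'.mul hXc').div hXa' ha0.ne'
      have haa := hXa'.pow 2
      refine Tendsto.div ((((habc.mul (hq1.pow 2)).const_sub 1).mul
        ((hac.mul hq1).const_sub 1)).mul ((hab.mul hq1).const_sub 1)).neg
        (hq1.sqrt.mul (((hbc.const_sub 1).mul ((haa.mul hq1).const_sub 1)).mul
          ((haa.mul (hq1.pow 2)).const_sub 1))) ?_
      simp [h1, h2]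
    convert hlim using 2
    have h4 : 1 - Xb * Xc / Xa = (Xa - Xb * Xc) / Xa := by field_simp
    rw [hya, sqrt_one, h4]
    field_simp
    ring
  · rw [thetaApolyA, hya]
    field_simp
    ring
end

section
/- Let x₁, x₂, x₃, x₄, x₁₂, x₂₃ and z be positive reals such that all eight numbers z, z/(x₁x₂x₁₂), z/(x₃x₄x₁₂), z/(x₁x₄x₂₃), z/(x₂x₃x₂₃), x₁x₂x₃x₄/z, x₁x₃x₁₂x₂₃/z, x₂x₄x₁₂x₂₃/z lie in (0,1). Then the tetrahedron Neumann–Zagier potential W̃₀ is differentiable in z and z · ∂W̃₀/∂z = log[ (1 − z)(z − x₁x₂x₃x₄)(z − x₁x₃x₁₂x₂₃)(z − x₂x₄x₁₂x₂₃) / ( (x₁x₂x₁₂ − z)(x₃x₄x₁₂ − z)(x₁x₄x₂₃ − z)(x₂x₃x₂₃ − z) ) ]; equivalently exp( z · ∂W̃₀/∂z ) = − (z − 1)(z − x₁x₂x₃x₄)(z − x₁x₃x₁₂x₂₃)(z − x₂x₄x₁₂x₂₃) / ( (z − x₁x₂x₁₂)(z − x₃x₄x₁₂)(z − x₁x₄x₂₃)(z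 − x₂x₃x₂₃) ), so that the saddle-point equation for W̃ = πi·log z + W̃₀ (i.e. z∂_zW̃₀ = −πi) takes the form 1 = (z−1)(z−x₁x₂x₃x₄)(z−x₁x₃x₁₂x₂₃)(z−x₂x₄x₁₂x₂₃) / ( (z−x₁x₂x₁₂)(z−x₁x₄x₂₃)(z−x₂x₃x₂₃)(z−x₃x₄x₁₂) ). -/
open Real

/-- The dilogarithm `Li₂(x) = ∑_{n≥1} xⁿ/n²`. -/
noncomputable def Li2 (x : ℝ) : ℝ := ∑' n : ℕ, x ^ (n + 1) / ((n : ℝ) + 1) ^ 2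

/-- The function `g(x) = -(log x)²/4 - Li₂(x)`. -/
noncomputable def gNZ (x : ℝ) : ℝ := -(Real.log x) ^ 2 / 4 - Li2 x

/-- The (log-free part of the) Neumann–Zagier potential of the tetrahedron graph:
`W̃₀ = g(z) - g(z/(x₁x₂x₁₂)) - g(z/(x₃x₄x₁₂)) - g(z/(x₁x₄x₂₃)) - g(z/(x₂x₃x₂₃))
  - g(x₁x₂x₃x₄/z) - g(x₁x₃x₁₂x₂₃/z) - g(x₂x₄x₁₂x₂₃/z)`. -/
noncomputable def tetW0 (x1 x2 x3 x4 x12 x23 z : ℝ) : ℝ :=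
  gNZ z - gNZ (z / (x1 * x2 * x12)) - gNZ (z / (x3 * x4 * x12)) -
    gNZ (z / (x1 * x4 * x23)) - gNZ (z / (x2 * x3 * x23)) -
    gNZ (x1 * x2 * x3 * x4 / z) - gNZ (x1 * x3 * x12 * x23 / z) -
    gNZ (x2 * x4 * x12 * x23 / z)

/-- On `0 < |x| < 1` the dilogarithm has derivative `-log (1 - x) / x`. -/
lemma hasDerivAt_Li2 {x : ℝ} (hx0 : x ≠ 0) (hx1 : |x| < 1) :
    HasDerivAt Li2 (-Real.log (1 - x) / x) x := by
  obtain ⟨r, hxr, hr1⟩ := exists_between hx1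
  have hr0 : 0 ≤ r := (abs_nonneg x).trans hxr.le
  have hsum : ∑' n : ℕ, x ^ n / ((n : ℝ) + 1) = -Real.log (1 - x) / x := by
    refine HasSum.tsum_eq ?_
    convert! (Real.hasSum_pow_div_log_of_abs_lt_one hx1).div_const x using 2 with n
    rw [pow_succ]
    field_simp
  rw [← hsum]
  refine hasDerivAt_tsum_of_isPreconnected (t := Metric.ball (0 : ℝ) r)
    (g := fun (n : ℕ) (y : ℝ) => y ^ (n + 1) / ((n : ℝ) + 1) ^ 2)
    (g' := fun (n : ℕ) (y : ℝ) => y ^ n / ((n : ℝ) + 1))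
    (summable_geometric_of_lt_one hr0 hr1) Metric.isOpen_ball
    (convex_ball (0 : ℝ) r).isPreconnected (fun n y _ => ?_) (fun n y hy => ?_)
    (y₀ := 0) ?_ ?_ ?_
  · refine ((hasDerivAt_pow (n + 1) y).div_const (((n : ℝ) + 1) ^ 2)).congr_deriv ?_
    rw [Nat.add_sub_cancel]
    push_cast
    field_simp
  · have hyr : |y| ≤ r := by
      simpa using (mem_ball_zero_iff.mp hy).le
    have hn : (1 : ℝ) ≤ (n : ℝ) + 1 := by linarith [Nat.cast_nonneg (α := ℝ) n]
    rw [Real.norm_eq_abs, abs_div, abs_pow, abs_of_pos (by linarith : (0 : ℝ) < (n : ℝ) + 1)]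
    exact (div_le_self (by positivity) hn).trans (by gcongr)
  · exact Metric.mem_ball_self ((abs_nonneg x).trans_lt hxr)
  · simp [summable_zero]
  · simpa using hxr

lemma hasDerivAt_gNZ {x : ℝ} (hx : x ∈ Set.Ioo (0 : ℝ) 1) :
    HasDerivAt gNZ ((-Real.log x / 2 + Real.log (1 - x)) / x) x := by
  have h := (((Real.hasDerivAt_log hx.1.ne').pow 2).neg.div_const 4).sub
    (hasDerivAt_Li2 hx.1.ne' (abs_lt.mpr ⟨by linarith [hx.1], hx.2⟩))
  refine h.congr_deriv ?_
  have := hx.1.ne'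
  field_simp
  push_cast
  ring

lemma hasDerivAt_gNZ_div_const {A z : ℝ} (hA : 0 < A) (hz : 0 < z)
    (h : z / A ∈ Set.Ioo (0 : ℝ) 1) :
    HasDerivAt (fun t => gNZ (t / A))
      ((-(Real.log z) / 2 - Real.log A / 2 + Real.log (A - z)) / z) z := by
  have hAz : 0 < A - z := sub_pos.mpr ((div_lt_one hA).mp h.2)
  refine ((hasDerivAt_gNZ h).comp z ((hasDerivAt_id z).div_const A)).congr_deriv ?_
  rw [one_sub_div hA.ne', Real.log_div hz.ne' hA.ne', Real.log_div hAz.ne' hA.ne']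
  field_simp
  ring

lemma hasDerivAt_gNZ_const_div {B z : ℝ} (hB : 0 < B) (hz : 0 < z)
    (h : B / z ∈ Set.Ioo (0 : ℝ) 1) :
    HasDerivAt (fun t => gNZ (B / t))
      ((Real.log B / 2 + Real.log z / 2 - Real.log (z - B)) / z) z := by
  have hzB : 0 < z - B := sub_pos.mpr ((div_lt_one hz).mp h.2)
  refine ((hasDerivAt_gNZ h).comp z
    ((hasDerivAt_const z B).div (hasDerivAt_id z) hz.ne')).congr_deriv ?_
  rw [one_sub_div hz.ne', Real.log_div hB.ne' hz.ne', Real.log_div hzB.ne' hz.ne']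
  field_simp
  ring

/-- `W̃₀` is differentiable in `z`, with
`z ∂W̃₀/∂z = log[(1-z)(z - x₁x₂x₃x₄)(z - x₁x₃x₁₂x₂₃)(z - x₂x₄x₁₂x₂₃) /
  ((x₁x₂x₁₂ - z)(x₃x₄x₁₂ - z)(x₁x₄x₂₃ - z)(x₂x₃x₂₃ - z))]`; equivalently
`exp(z ∂W̃₀/∂z) = -(z-1)(z - x₁x₂x₃x₄)(z - x₁x₃x₁₂x₂₃)(z - x₂x₄x₁₂x₂₃) /
  ((z - x₁x₂x₁₂)(z - x₃x₄x₁₂)(z - x₁x₄x₂₃)(z - x₂x₃x₂₃))`, so that the saddle-point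
equation `z ∂W̃₀/∂z = -πi` for `W̃ = πi log z + W̃₀` (whose exponentiated form reads
`exp(z ∂W̃₀/∂z) = -1`) takes the form
`1 = (z-1)(z-x₁x₂x₃x₄)(z-x₁x₃x₁₂x₂₃)(z-x₂x₄x₁₂x₂₃) /
  ((z-x₁x₂x₁₂)(z-x₁x₄x₂₃)(z-x₂x₃x₂₃)(z-x₃x₄x₁₂))`. -/
theorem tetW0_deriv_z (x1 x2 x3 x4 x12 x23 z : ℝ)
    (hx1 : 0 < x1) (hx2 : 0 < x2) (hx3 : 0 < x3) (hx4 : 0 < x4)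
    (hx12 : 0 < x12) (hx23 : 0 < x23)
    (h0 : z ∈ Set.Ioo (0 : ℝ) 1)
    (h1 : z / (x1 * x2 * x12) ∈ Set.Ioo (0 : ℝ) 1)
    (h2 : z / (x3 * x4 * x12) ∈ Set.Ioo (0 : ℝ) 1)
    (h3 : z / (x1 * x4 * x23) ∈ Set.Ioo (0 : ℝ) 1)
    (h4 : z / (x2 * x3 * x23) ∈ Set.Ioo (0 : ℝ) 1)
    (h5 : x1 * x2 * x3 * x4 / z ∈ Set.Ioo (0 : ℝ) 1)
    (h6 : x1 * x3 * x12 * x23 / z ∈ Set.Ioo (0 : ℝ) 1)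
    (h7 : x2 * x4 * x12 * x23 / z ∈ Set.Ioo (0 : ℝ) 1) :
    DifferentiableAt ℝ (fun t => tetW0 x1 x2 x3 x4 x12 x23 t) z ∧
    z * deriv (fun t => tetW0 x1 x2 x3 x4 x12 x23 t) z =
      Real.log ((1 - z) * (z - x1 * x2 * x3 * x4) * (z - x1 * x3 * x12 * x23) *
          (z - x2 * x4 * x12 * x23) /
        ((x1 * x2 * x12 - z) * (x3 * x4 * x12 - z) * (x1 * x4 * x23 - z) *
          (x2 * x3 * x23 - z))) ∧
    Real.exp (z * deriv (fun t => tetW0 x1 x2 x3 x4 x12 x23 t) z) =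
      -((z - 1) * (z - x1 * x2 * x3 * x4) * (z - x1 * x3 * x12 * x23) *
          (z - x2 * x4 * x12 * x23) /
        ((z - x1 * x2 * x12) * (z - x3 * x4 * x12) * (z - x1 * x4 * x23) *
          (z - x2 * x3 * x23))) ∧
    (Real.exp (z * deriv (fun t => tetW0 x1 x2 x3 x4 x12 x23 t) z) = -1 ↔
      1 = (z - 1) * (z - x1 * x2 * x3 * x4) * (z - x1 * x3 * x12 * x23) *
          (z - x2 * x4 * x12 * x23) /
        ((z - x1 * x2 * x12) * (z - x1 * x4 * x23) * (z - x2 * x3 * x23) *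
          (z - x3 * x4 * x12))) := by
  have hz := h0.1
  have hz1 : 0 < 1 - z := sub_pos.mpr h0.2
  have a1 : 0 < x1 * x2 * x12 - z := sub_pos.mpr ((div_lt_one (by positivity)).mp h1.2)
  have a2 : 0 < x3 * x4 * x12 - z := sub_pos.mpr ((div_lt_one (by positivity)).mp h2.2)
  have a3 : 0 < x1 * x4 * x23 - z := sub_pos.mpr ((div_lt_one (by positivity)).mp h3.2)
  have a4 : 0 < x2 * x3 * x23 - z := sub_pos.mpr ((div_lt_one (by positivity)).mp h4.2)
  have b1 : 0 < z - x1 * x2 * x3 * x4 := sub_pos.mpr ((div_lt_one hz).mp h5.2)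
  have b2 : 0 < z - x1 * x3 * x12 * x23 := sub_pos.mpr ((div_lt_one hz).mp h6.2)
  have b3 : 0 < z - x2 * x4 * x12 * x23 := sub_pos.mpr ((div_lt_one hz).mp h7.2)
  have hD : HasDerivAt (fun t => tetW0 x1 x2 x3 x4 x12 x23 t) _ z :=
    (((((((hasDerivAt_gNZ h0).sub
      (hasDerivAt_gNZ_div_const (by positivity) hz h1)).sub
      (hasDerivAt_gNZ_div_const (by positivity) hz h2)).sub
      (hasDerivAt_gNZ_div_const (by positivity) hz h3)).sub
      (hasDerivAt_gNZ_div_const (by positivity) hz h4)).sub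
      (hasDerivAt_gNZ_const_div (by positivity) hz h5)).sub
      (hasDerivAt_gNZ_const_div (by positivity) hz h6)).sub
      (hasDerivAt_gNZ_const_div (by positivity) hz h7)
  have hlog : z * deriv (fun t => tetW0 x1 x2 x3 x4 x12 x23 t) z =
      Real.log ((1 - z) * (z - x1 * x2 * x3 * x4) * (z - x1 * x3 * x12 * x23) *
          (z - x2 * x4 * x12 * x23) /
        ((x1 * x2 * x12 - z) * (x3 * x4 * x12 - z) * (x1 * x4 * x23 - z) *
          (x2 * x3 * x23 - z))) := by
    rw [hD.deriv, Real.log_div (by positivity) (by positivity),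
      Real.log_mul (by positivity) b3.ne', Real.log_mul (by positivity) b2.ne',
      Real.log_mul hz1.ne' b1.ne', Real.log_mul (by positivity) a4.ne',
      Real.log_mul (by positivity) a3.ne', Real.log_mul a1.ne' a2.ne']
    have hprod : Real.log (x1 * x2 * x12) + Real.log (x3 * x4 * x12) +
        Real.log (x1 * x4 * x23) + Real.log (x2 * x3 * x23) =
        Real.log (x1 * x2 * x3 * x4) + Real.log (x1 * x3 * x12 * x23) +
        Real.log (x2 * x4 * x12 * x23) := by
      simp only [Real.log_mul, hx1.ne', hx2.ne', hx3.ne', hx4.ne', hx12.ne', hx23.ne',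
        mul_ne_zero_iff, ne_eq, not_false_eq_true, and_self]
      ring
    simp only [← sub_div]
    rw [mul_div_cancel₀ _ hz.ne']
    linear_combination hprod / 2
  have hexp : Real.exp (z * deriv (fun t => tetW0 x1 x2 x3 x4 x12 x23 t) z) =
      -((z - 1) * (z - x1 * x2 * x3 * x4) * (z - x1 * x3 * x12 * x23) *
          (z - x2 * x4 * x12 * x23) /
        ((z - x1 * x2 * x12) * (z - x3 * x4 * x12) * (z - x1 * x4 * x23) *
          (z - x2 * x3 * x23))) := by
    rw [hlog, Real.exp_log (by positivity), ← neg_div]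
    congr 1 <;> ring
  refine ⟨hD.differentiableAt, hlog, hexp, ?_⟩
  rw [hexp, neg_inj, eq_comm, mul_right_comm (z - x1 * x2 * x12),
    mul_right_comm ((z - x1 * x2 * x12) * (z - x1 * x4 * x23))]
end
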